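/- Let u be a smooth divergence-free vector field on T³×[0,T], let A₁, A₂ : T³×[0,T] → ℝ^{3×3} be smooth, symmetric, uniformly elliptic matrix fields, let ρ_in be smooth, and let ϱ₁, ϱ₂ be the smooth solutions of ∂ₜϱ₁ + u·∇ϱ₁ = div(A₁∇ϱ₁) and ∂ₜϱ₂ + u·∇ϱ₂ = div(A₂∇ϱ₂) on T³×[0,T] with ϱ₁(0) = ϱ₂(0) = ρ_in. Assume that for some ε ≤ 1/10 one has |(A₁−A₂)ξ·ζ| ≤ ε (A₁ξ·ξ)^{1/2}(A₁ζ·ζ)^{1/2} for all (x,t) ∈ T³×[0,T] and all ξ, ζ ∈ ℝ³. Then for every t ∈ [0,T]: ‖ϱ₁(t) − ϱ₂(t)‖²_{L²} ≤ 2ε² |‖ρ_in‖²_{L²} − ‖ϱ₂(t)‖²_{L²}| and |‖ϱ₁(t)‖²_{L²} − ‖ϱ₂(t)‖²_{L²}| ≤ 10ε |‖ρ_in‖²_{L²} − ‖ϱ₂(t)‖²_{L²}|. -/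

import Mathlib

/-!
STATEMENT 8 (Proposition `p:stability_in_ellipticity`): stability estimates comparing
solutions of two advection–diffusion equations with elliptic matrices `A₁, A₂` on the
3-torus.  Matrices are `M3 = Fin 3 → Fin 3 → ℝ`, `qf A ξ ζ = A ξ · ζ`.
-/

open MeasureTheory Real Set Filter

noncomputable section

abbrev Ed (d : ℕ) : Type := EuclideanSpace ℝ (Fin d)
abbrev E3 : Type := Ed 3

def cube (d : ℕ) : Set (Ed d) := {x : Ed d | ∀ i, 0 ≤ x i ∧ x i < 1}

def SpacePeriodic {d : ℕ} {α : Type*} (f : Ed d → α) : Prop :=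
  ∀ (x : Ed d) (m : Fin d → ℤ),
    f (x + ∑ i, (m i : ℝ) • EuclideanSpace.single i (1:ℝ)) = f x

def spd {d : ℕ} (i : Fin d) (f : Ed d → ℝ) (x : Ed d) : ℝ :=
  fderiv ℝ f x (EuclideanSpace.single i (1:ℝ))

def divg {d : ℕ} (u : Ed d → Ed d) (x : Ed d) : ℝ :=
  ∑ i, spd i (fun y => u y i) x

def L2sq {d : ℕ} (f : Ed d → ℝ) : ℝ := ∫ x in cube d, (f x) ^ 2

abbrev M3 : Type := Fin 3 → Fin 3 → ℝ

def qf (A : M3) (v w : Fin 3 → ℝ) : ℝ := ∑ i, ∑ j, A i j * v i * w j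

def SmoothTS {d : ℕ} {F : Type*} [NormedAddCommGroup F] [NormedSpace ℝ F]
    (f : ℝ → Ed d → F) : Prop :=
  ContDiff ℝ (⊤ : ℕ∞) (fun p : ℝ × Ed d => f p.1 p.2)

/-- `ϱ` solves `∂ₜϱ + u·∇ϱ = div(A∇ϱ)` on `T³ × [0,T]` with datum `ρin`. -/
def SolvesAdvDiffA (T : ℝ) (u : ℝ → E3 → E3) (A : ℝ → E3 → M3)
    (ρin : E3 → ℝ) (ϱ : ℝ → E3 → ℝ) : Prop :=
  SmoothTS ϱ ∧ (∀ t, SpacePeriodic (ϱ t)) ∧ (∀ x, ϱ 0 x = ρin x) ∧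
  ∀ t ∈ Icc (0:ℝ) T, ∀ x,
    deriv (fun s => ϱ s x) t + ∑ i, u t x i * spd i (ϱ t) x
      = ∑ i, spd i (fun y => ∑ j, A t y i j * spd j (ϱ t) y) x

lemma cube_subset_closed_box (d : ℕ) :
    cube d ⊆ WithLp.toLp 2 '' Icc (0 : Fin d → ℝ) 1 := fun x hx =>
  ⟨WithLp.ofLp x, ⟨fun i => (hx i).1, fun i => (hx i).2.le⟩, rfl⟩

lemma isCompact_closed_box (d : ℕ) :
    IsCompact ((WithLp.toLp 2 : (Fin d → ℝ) → Ed d) '' Icc (0 : Fin d → ℝ) 1) :=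
  isCompact_Icc.image (PiLp.continuous_toLp 2 _)

lemma measurableSet_cube (d : ℕ) : MeasurableSet (cube d) := by
  have h : cube d = ⋂ i, ({x : Ed d | 0 ≤ x i} ∩ {x : Ed d | x i < 1}) := by
    ext x; simp [cube]
  rw [h]
  refine MeasurableSet.iInter fun i => ?_
  have hc : Continuous fun x : Ed d => x i := by fun_prop
  exact (measurableSet_le measurable_const hc.measurable).inter
    (measurableSet_lt hc.measurable measurable_const)

lemma integrableOn_cube {d : ℕ} {f : Ed d → ℝ} (hf : Continuous f) :
    IntegrableOn f (cube d) :=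
  (hf.continuousOn.integrableOn_compact (isCompact_closed_box d)).mono_set
    (cube_subset_closed_box d)

lemma setIntegral_cube_eq {d : ℕ} (f : Ed d → ℝ) :
    ∫ x in cube d, f x = ∫ y in Icc (0 : Fin d → ℝ) 1, f (WithLp.toLp 2 y) := by
  have h := (PiLp.volume_preserving_toLp (Fin d)).setIntegral_preimage_emb
    (MeasurableEquiv.toLp 2 (Fin d → ℝ)).measurableEmbedding f (cube d)
  rw [← h]
  have hpre : (WithLp.toLp 2 : (Fin d → ℝ) → Ed d) ⁻¹' cube d
      = Set.pi univ fun i => Ico ((0 : Fin d → ℝ) i) ((1 : Fin d → ℝ) i) := by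
    ext y; simp [cube]
  rw [hpre]
  exact setIntegral_congr_set Measure.univ_pi_Ico_ae_eq_Icc

/-- The divergence of a periodic `C¹` field has zero mean. -/
lemma integral_divergence_eq_zero {n : ℕ} (F : Fin (n + 1) → Ed (n + 1) → ℝ)
    (hF : ∀ i, ContDiff ℝ 1 (F i)) (hper : ∀ i, SpacePeriodic (F i)) :
    ∫ x in cube (n + 1), ∑ i, spd i (F i) x = 0 := by
  rw [setIntegral_cube_eq]
  let eL : (Fin (n + 1) → ℝ) →L[ℝ] Ed (n + 1) :=
    ((EuclideanSpace.equiv (Fin (n + 1)) ℝ).symm : (Fin (n + 1) → ℝ) →L[ℝ] Ed (n + 1))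
  have heL : ∀ y, eL y = WithLp.toLp 2 y := fun y => rfl
  have key := integral_divergence_of_hasFDerivAt_off_countable' (0 : Fin (n + 1) → ℝ) 1
    zero_le_one (fun i y => F i (eL y)) (fun i y => (fderiv ℝ (F i) (eL y)).comp eL) ∅
    countable_empty
    (fun i => ((hF i).continuous.comp eL.continuous).continuousOn)
    (fun y _ i => (((hF i).differentiable one_ne_zero) (eL y)).hasFDerivAt.comp y
      eL.hasFDerivAt)
    (by
      refine ContinuousOn.integrableOn_compact isCompact_Icc (Continuous.continuousOn ?_)
      refine continuous_finsetSum _ fun i _ => ?_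
      have := (hF i).continuous_fderiv one_ne_zero
      simp only [ContinuousLinearMap.comp_apply]
      exact (this.comp eL.continuous).clm_apply continuous_const)
  refine Eq.trans ?_ (key.trans ?_)
  · rfl
  · refine Finset.sum_eq_zero fun i _ => sub_eq_zero.2 ?_
    congr 1
    ext y
    have h := hper i (eL (i.insertNth 0 y)) (Pi.single i 1)
    have : eL (i.insertNth 1 y) = eL (i.insertNth 0 y)
        + ∑ j, ((Pi.single i 1 : Fin (n + 1) → ℤ) j : ℝ) • EuclideanSpace.single j (1 : ℝ) := by
      rw [Finset.sum_eq_single i (by intro j _ hj; simp [hj]) (by simp)]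
      ext j
      refine Fin.succAboveCases i ?_ (fun k => ?_) j <;> simp [heL]
    simp only [Pi.one_apply, Pi.zero_apply]
    rw [this, h]

lemma SmoothTS.slice {d : ℕ} {F : Type*} [NormedAddCommGroup F] [NormedSpace ℝ F]
    {f : ℝ → Ed d → F} (hf : SmoothTS f) (t : ℝ) : ContDiff ℝ (⊤ : ℕ∞) (f t) :=
  ContDiff.comp (g := fun p : ℝ × Ed d => f p.1 p.2) hf (contDiff_prodMk_right t)

lemma SmoothTS.hasDerivAt_time {d : ℕ} {f : ℝ → Ed d → ℝ} (hf : SmoothTS f) (t : ℝ)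
    (x : Ed d) : HasDerivAt (fun s => f s x)
      (fderiv ℝ (fun p : ℝ × Ed d => f p.1 p.2) (t, x) (1, 0)) t := by
  have h1 : HasFDerivAt (fun p : ℝ × Ed d => f p.1 p.2) _ (t, x) :=
    ((ContDiff.differentiable hf (by simp)) (t, x)).hasFDerivAt
  have h2 : HasDerivAt (fun s : ℝ => (s, x)) ((1 : ℝ), (0 : Ed d)) t :=
    (hasDerivAt_id t).prodMk (hasDerivAt_const t x)
  exact h1.comp_hasDerivAt t h2

lemma SmoothTS.continuous_fderiv_time {d : ℕ} {f : ℝ → Ed d → ℝ} (hf : SmoothTS f) :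
    Continuous fun p : ℝ × Ed d =>
      fderiv ℝ (fun p : ℝ × Ed d => f p.1 p.2) p (1, 0) :=
  (ContDiff.continuous_fderiv hf (by simp)).clm_apply continuous_const

lemma SmoothTS.hasDerivAt_L2sq {d : ℕ} {f : ℝ → Ed d → ℝ} (hf : SmoothTS f) (t : ℝ) :
    HasDerivAt (fun s => L2sq (f s))
      (∫ x in cube d, 2 * f t x * deriv (fun s => f s x) t) t := by
  have hd : ∀ s x, deriv (fun s => f s x) s
      = fderiv ℝ (fun p : ℝ × Ed d => f p.1 p.2) (s, x) (1, 0) :=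
    fun s x => (hf.hasDerivAt_time s x).deriv
  have hc : Continuous fun p : ℝ × Ed d =>
      2 * f p.1 p.2 * fderiv ℝ (fun p : ℝ × Ed d => f p.1 p.2) p (1, 0) :=
    (continuous_const.mul (ContDiff.continuous hf)).mul hf.continuous_fderiv_time
  obtain ⟨C, hC⟩ := ((isCompact_Icc (a := t - 1) (b := t + 1)).prod
    (isCompact_closed_box d)).exists_bound_of_continuousOn hc.continuousOn
  simp only [hd]
  have hcs : ∀ s, Continuous fun x => f s x := fun s => (hf.slice s).continuous
  refine (hasDerivAt_integral_of_dominated_loc_of_deriv_le (μ := volume.restrict (cube d))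
    (F := fun s x => f s x ^ 2)
    (F' := fun s x => 2 * f s x * fderiv ℝ (fun p : ℝ × Ed d => f p.1 p.2) (s, x) (1, 0))
    (bound := fun _ => C) (Icc_mem_nhds (by linarith : t - 1 < t) (by linarith : t < t + 1))
    (Eventually.of_forall fun s => ((hcs s).pow 2).aestronglyMeasurable)
    (integrableOn_cube ((hcs t).pow 2))
    (hc.comp (Continuous.prodMk_right t)).aestronglyMeasurable ?_
    (integrableOn_cube continuous_const) ?_).2
  · refine (ae_restrict_iff' (measurableSet_cube d)).2 (Eventually.of_forall fun x hx s hs => ?_)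
    exact hC (s, x) ⟨hs, cube_subset_closed_box d hx⟩
  · refine Eventually.of_forall fun x s _ => ?_
    have h := (hf.hasDerivAt_time s x).fun_pow 2
    simpa using h

lemma contDiff_spd {d : ℕ} {f : Ed d → ℝ} (hf : ContDiff ℝ (⊤ : ℕ∞) f) (i : Fin d) :
    ContDiff ℝ (⊤ : ℕ∞) (spd i f) :=
  (hf.fderiv_right (m := (⊤ : ℕ∞)) (by simp)).clm_apply contDiff_const

lemma SpacePeriodic.spd {d : ℕ} {f : Ed d → ℝ} (hf : SpacePeriodic f) (i : Fin d) :
    SpacePeriodic (spd i f) := by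
  intro x m
  unfold _root_.spd
  rw [← fderiv_comp_add_right]
  simp_rw [hf _ m]

lemma spd_mul {d : ℕ} {f g : Ed d → ℝ} {x : Ed d} (hf : DifferentiableAt ℝ f x)
    (hg : DifferentiableAt ℝ g x) (i : Fin d) :
    spd i (fun y => f y * g y) x = f x * spd i g x + g x * spd i f x := by
  unfold spd
  rw [fderiv_fun_mul hf hg]
  simp

lemma spd_sub {d : ℕ} {f g : Ed d → ℝ} {x : Ed d} (hf : DifferentiableAt ℝ f x)
    (hg : DifferentiableAt ℝ g x) (i : Fin d) :
    spd i (fun y => f y - g y) x = spd i f x - spd i g x := by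
  unfold spd
  rw [fderiv_fun_sub hf hg]
  simp

/-- Energy identity for `∂ₜf + v·∇f = div g` with `v` divergence free. -/
lemma hasDerivAt_L2sq_of_transport {n : ℕ} {f : ℝ → Ed (n + 1) → ℝ} (hf : SmoothTS f) {t : ℝ}
    (hfp : SpacePeriodic (f t)) {v : Ed (n + 1) → Ed (n + 1)} (hv : ContDiff ℝ (⊤ : ℕ∞) v)
    (hvp : SpacePeriodic v) (hdiv : ∀ x, divg v x = 0)
    {g : Fin (n + 1) → Ed (n + 1) → ℝ} (hg : ∀ i, ContDiff ℝ (⊤ : ℕ∞) (g i))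
    (hgp : ∀ i, SpacePeriodic (g i))
    (heq : ∀ x, deriv (fun s => f s x) t + ∑ i, v x i * spd i (f t) x = ∑ i, spd i (g i) x) :
    HasDerivAt (fun s => L2sq (f s))
      (-2 * ∫ x in cube (n + 1), ∑ i, g i x * spd i (f t) x) t := by
  have hft := hf.slice t
  have hvi : ∀ i, ContDiff ℝ (⊤ : ℕ∞) fun x => v x i := fun i => by fun_prop
  let F : Fin (n + 1) → Ed (n + 1) → ℝ := fun i x => f t x * (2 * g i x - v x i * f t x)
  have hF : ∀ i, ContDiff ℝ (⊤ : ℕ∞) (F i) := fun i =>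
    hft.mul ((contDiff_const.mul (hg i)).sub ((hvi i).mul hft))
  have h0 := integral_divergence_eq_zero F (fun i => (hF i).of_le (by simp)) (by
    intro i x m
    simp only [F, hfp x m, hgp i x m, hvp x m])
  have hpt : ∀ x, 2 * f t x * deriv (fun s => f s x) t
      = (∑ i, spd i (F i) x) + (-2) * ∑ i, g i x * spd i (f t) x := by
    intro x
    have hne : ((⊤ : ℕ∞) : WithTop ℕ∞) ≠ 0 := by simp
    have df := hft.differentiable hne x
    have dg := fun i => (hg i).differentiable hne x
    have dv := fun i => (hvi i).differentiable hne x
    have hi : ∀ i, spd i (F i) x = 2 * f t x * spd i (g i) x + 2 * (g i x * spd i (f t) x)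
        - f t x ^ 2 * spd i (fun y => v y i) x - 2 * f t x * (v x i * spd i (f t) x) := by
      intro i
      have h2 : spd i (fun y => 2 * g i y) x = 2 * spd i (g i) x := by
        rw [spd_mul (differentiableAt_const _) (dg i)]
        simp [spd]
      have dg2 : DifferentiableAt ℝ (fun y => 2 * g i y) x := (dg i).const_mul 2
      have dvf : DifferentiableAt ℝ (fun y => v y i * f t y) x := (dv i).mul df
      have dsub : DifferentiableAt ℝ (fun y => 2 * g i y - v y i * f t y) x := dg2.sub dvf
      rw [show spd i (F i) x = spd i (fun y => f t y * (2 * g i y - v y i * f t y)) x from rfl,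
        spd_mul df dsub, spd_sub dg2 dvf, h2, spd_mul (dv i) df]
      ring
    simp only [hi, Finset.sum_sub_distrib, Finset.sum_add_distrib, ← Finset.mul_sum]
    have hdx : ∑ i, spd i (fun y => v y i) x = 0 := hdiv x
    rw [hdx, ← heq x]
    ring
  have hE := hf.hasDerivAt_L2sq t
  simp only [hpt] at hE
  have hc1 : Continuous fun x => ∑ i, spd i (F i) x :=
    continuous_finsetSum _ fun i _ => (contDiff_spd (hF i) i).continuous
  have hc2 : Continuous fun x => ∑ i, g i x * spd i (f t) x :=
    continuous_finsetSum _ fun i _ => (hg i).continuous.mul (contDiff_spd hft i).continuous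
  rw [integral_add (integrableOn_cube hc1) ((integrableOn_cube hc2).const_mul _), h0, zero_add,
    integral_const_mul] at hE
  exact hE

lemma qf_comm_of_symm {A : M3} (hA : ∀ i j, A i j = A j i) (v w : Fin 3 → ℝ) :
    qf A v w = qf A w v := by
  unfold qf
  rw [Finset.sum_comm]
  refine Finset.sum_congr rfl fun i _ => Finset.sum_congr rfl fun j _ => ?_
  rw [hA j i]; ring

lemma qf_add_smul {A : M3} (hA : ∀ i j, A i j = A j i) (v w : Fin 3 → ℝ) (s : ℝ) :
    qf A (fun i => v i + s * w i) (fun i => v i + s * w i)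
      = qf A v v + 2 * s * qf A v w + s ^ 2 * qf A w w := by
  have h : qf A (fun i => v i + s * w i) (fun i => v i + s * w i)
      = qf A v v + s * qf A v w + s * qf A w v + s ^ 2 * qf A w w := by
    simp only [qf, Fin.sum_univ_three]; ring
  rw [h, qf_comm_of_symm hA w v]; ring

lemma qf_matrix_sub (A B : M3) (v w : Fin 3 → ℝ) :
    qf (fun i j => A i j - B i j) v w = qf A v w - qf B v w := by
  simp only [qf, Fin.sum_univ_three]; ring

section Pointwise

variable {A B : M3} {ε : ℝ}

lemma abs_qf_sub_self_le (hpos : ∀ v, 0 ≤ qf A v v)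
    (hclose : ∀ ξ ζ : Fin 3 → ℝ, |qf (fun i j => A i j - B i j) ξ ζ|
        ≤ ε * Real.sqrt (qf A ξ ξ) * Real.sqrt (qf A ζ ζ)) (r : Fin 3 → ℝ) :
    |qf A r r - qf B r r| ≤ ε * qf A r r := by
  have h := hclose r r
  rwa [qf_matrix_sub, mul_assoc, Real.mul_self_sqrt (hpos r)] at h

/-- Coercivity, up to an `ε²` error, of the dissipation of the difference `w`. -/
lemma difference_dissipation_ge (hpos : ∀ v, 0 ≤ qf A v v)
    (hclose : ∀ ξ ζ : Fin 3 → ℝ, |qf (fun i j => A i j - B i j) ξ ζ|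
        ≤ ε * Real.sqrt (qf A ξ ξ) * Real.sqrt (qf A ζ ζ)) (w r : Fin 3 → ℝ) :
    qf A w w - ε ^ 2 * qf A r r ≤ 2 * (qf A w w + (qf A w r - qf B w r)) := by
  have h := hclose w r
  rw [qf_matrix_sub] at h
  have h1 := Real.sq_sqrt (hpos w)
  have h2 := Real.sq_sqrt (hpos r)
  have h3 := (abs_le.1 h).1
  nlinarith [sq_nonneg (Real.sqrt (qf A w w) - ε * Real.sqrt (qf A r r))]

lemma two_mul_abs_qf_le (hsym : ∀ i j, A i j = A j i) (hpos : ∀ v, 0 ≤ qf A v v) (hε : 0 < ε)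
    (w r : Fin 3 → ℝ) : 2 * |qf A w r| ≤ qf A w w / ε + ε * qf A r r := by
  have h1 := hpos (fun i => w i + ε * r i)
  have h2 := hpos (fun i => w i + (-ε) * r i)
  rw [qf_add_smul hsym] at h1 h2
  have h3 : 2 * ε * |qf A w r| ≤ qf A w w + ε ^ 2 * qf A r r := by
    rcases abs_cases (qf A w r) with h | h <;> rw [h.1] <;> linarith
  have h4 : qf A w w / ε + ε * qf A r r = (qf A w w + ε ^ 2 * qf A r r) / ε := by
    field_simp
  rw [h4, le_div_iff₀ hε]
  linarith

lemma dissipation_combination_nonneg (hpos : ∀ v, 0 ≤ qf A v v) (hε : ε ≤ 1 / 10)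
    (hclose : ∀ ξ ζ : Fin 3 → ℝ, |qf (fun i j => A i j - B i j) ξ ζ|
        ≤ ε * Real.sqrt (qf A ξ ξ) * Real.sqrt (qf A ζ ζ)) (w r : Fin 3 → ℝ) :
    0 ≤ 2 * ε ^ 2 * qf B r r + (qf A w w + (qf A w r - qf B w r)) := by
  have h1 := difference_dissipation_ge hpos hclose w r
  have h2 := (abs_le.1 (abs_qf_sub_self_le hpos hclose r)).2
  have hw := hpos w
  have hr := hpos r
  have h3 : 9 / 10 * qf A r r ≤ qf B r r := by nlinarith
  nlinarith [mul_le_mul_of_nonneg_left h3 (sq_nonneg ε), mul_nonneg (sq_nonneg ε) hr]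

lemma signed_dissipation_combination_nonneg (hsym : ∀ i j, A i j = A j i)
    (hpos : ∀ v, 0 ≤ qf A v v) (hε0 : 0 < ε) (hε : ε ≤ 1 / 10)
    (hclose : ∀ ξ ζ : Fin 3 → ℝ, |qf (fun i j => A i j - B i j) ξ ζ|
        ≤ ε * Real.sqrt (qf A ξ ξ) * Real.sqrt (qf A ζ ζ)) (w r : Fin 3 → ℝ)
    {σ : ℝ} (hσ : |σ| = 1) :
    0 ≤ (10 * ε - σ) * qf B r r + σ * (qf A w w + 2 * qf A w r + qf A r r)
      + (2 + 2 / ε) * (qf A w w + (qf A w r - qf B w r)) := by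
  have h1 := difference_dissipation_ge hpos hclose w r
  have h2 := abs_qf_sub_self_le hpos hclose r
  have h4 := two_mul_abs_qf_le hsym hpos hε0 w r
  have hw := hpos w
  have hr := hpos r
  have h3 : 9 / 10 * qf A r r ≤ qf B r r := by nlinarith [(abs_le.1 h2).2]
  have h5 : |σ * (qf A w w + 2 * qf A w r + (qf A r r - qf B r r))|
      ≤ qf A w w + (qf A w w / ε + ε * qf A r r) + ε * qf A r r := by
    rw [abs_mul, hσ, one_mul]
    refine (abs_add_three _ _ _).trans ?_
    rw [abs_of_nonneg hw, abs_mul, abs_two]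
    linarith
  have h6 := (abs_le.1 h5).1
  have h7 : (1 + 1 / ε) * (qf A w w - ε ^ 2 * qf A r r)
      ≤ (1 + 1 / ε) * (2 * (qf A w w + (qf A w r - qf B w r))) :=
    mul_le_mul_of_nonneg_left h1 (by positivity)
  have h8 : (1 + 1 / ε) * (qf A w w - ε ^ 2 * qf A r r)
      = qf A w w + qf A w w / ε - ε ^ 2 * qf A r r - ε * qf A r r := by
    field_simp
    ring
  have h9 : (2 + 2 / ε) * (qf A w w + (qf A w r - qf B w r))
      = (1 + 1 / ε) * (2 * (qf A w w + (qf A w r - qf B w r))) := by ring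
  have h10 := mul_le_mul_of_nonneg_left h3 hε0.le
  have h11 := mul_nonneg hε0.le hr
  nlinarith [mul_le_mul_of_nonneg_right hε h11]

end Pointwise

lemma L2sq_nonneg {d : ℕ} (f : Ed d → ℝ) : 0 ≤ L2sq f :=
  integral_nonneg fun _ => sq_nonneg _

lemma flux_contDiff {A : ℝ → E3 → M3} (hA : SmoothTS A) {ϱ : ℝ → E3 → ℝ} (hϱ : SmoothTS ϱ)
    (t : ℝ) (i : Fin 3) :
    ContDiff ℝ (⊤ : ℕ∞) fun y => ∑ j, A t y i j * spd j (ϱ t) y := by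
  refine ContDiff.sum fun j _ => ContDiff.mul ?_ (contDiff_spd (hϱ.slice t) j)
  exact contDiff_pi.1 (contDiff_pi.1 (hA.slice t) i) j

lemma flux_periodic {A : ℝ → E3 → M3} {ϱ : ℝ → E3 → ℝ} {t : ℝ} (hA : SpacePeriodic (A t))
    (hϱ : SpacePeriodic (ϱ t)) (i : Fin 3) :
    SpacePeriodic fun y => ∑ j, A t y i j * spd j (ϱ t) y := by
  intro x m
  simp only [hA x m, hϱ.spd _ x m]

theorem stability_in_ellipticity
    (T : ℝ) (hT : 0 < T)
    (u : ℝ → E3 → E3) (hu : SmoothTS u) (hup : ∀ t, SpacePeriodic (u t))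
    (hudiv : ∀ t x, divg (u t) x = 0)
    (A₁ A₂ : ℝ → E3 → M3) (hA₁s : SmoothTS A₁) (hA₂s : SmoothTS A₂)
    (hA₁p : ∀ t, SpacePeriodic (A₁ t)) (hA₂p : ∀ t, SpacePeriodic (A₂ t))
    (hA₁sym : ∀ t x i j, A₁ t x i j = A₁ t x j i)
    (hA₂sym : ∀ t x i j, A₂ t x i j = A₂ t x j i)
    -- uniform ellipticity
    (hA₁ell : ∃ c > 0, ∀ t ∈ Icc (0:ℝ) T, ∀ x v, c * (∑ i, (v i)^2) ≤ qf (A₁ t x) v v)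
    (hA₂ell : ∃ c > 0, ∀ t ∈ Icc (0:ℝ) T, ∀ x v, c * (∑ i, (v i)^2) ≤ qf (A₂ t x) v v)
    (ρin : E3 → ℝ) (hρin : ContDiff ℝ (⊤ : ℕ∞) ρin) (hρinp : SpacePeriodic ρin)
    (ϱ₁ ϱ₂ : ℝ → E3 → ℝ)
    (h₁ : SolvesAdvDiffA T u A₁ ρin ϱ₁) (h₂ : SolvesAdvDiffA T u A₂ ρin ϱ₂)
    (ε : ℝ) (hε0 : 0 < ε) (hε : ε ≤ 1/10)
    -- |(A₁−A₂)ξ·ζ| ≤ ε (A₁ξ·ξ)^{1/2} (A₁ζ·ζ)^{1/2}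
    (hclose : ∀ t ∈ Icc (0:ℝ) T, ∀ x, ∀ ξ ζ : Fin 3 → ℝ,
      |qf (fun i j => A₁ t x i j - A₂ t x i j) ξ ζ|
        ≤ ε * Real.sqrt (qf (A₁ t x) ξ ξ) * Real.sqrt (qf (A₁ t x) ζ ζ)) :
    ∀ t ∈ Icc (0:ℝ) T,
      L2sq (fun x => ϱ₁ t x - ϱ₂ t x) ≤ 2 * ε^2 * |L2sq ρin - L2sq (ϱ₂ t)| ∧
      |L2sq (ϱ₁ t) - L2sq (ϱ₂ t)| ≤ 10 * ε * |L2sq ρin - L2sq (ϱ₂ t)| := by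
  obtain ⟨s₁, p₁, i₁, e₁⟩ := h₁
  obtain ⟨s₂, p₂, i₂, e₂⟩ := h₂
  let W : ℝ → E3 → ℝ := fun t x => ϱ₁ t x - ϱ₂ t x
  have sW : SmoothTS W := ContDiff.sub s₁ s₂
  let g₁ : ℝ → Fin 3 → E3 → ℝ := fun t i y => ∑ j, A₁ t y i j * spd j (ϱ₁ t) y
  let g₂ : ℝ → Fin 3 → E3 → ℝ := fun t i y => ∑ j, A₂ t y i j * spd j (ϱ₂ t) y
  have cg₁ : ∀ t i, ContDiff ℝ (⊤ : ℕ∞) (g₁ t i) := fun t i => flux_contDiff hA₁s s₁ t i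
  have cg₂ : ∀ t i, ContDiff ℝ (⊤ : ℕ∞) (g₂ t i) := fun t i => flux_contDiff hA₂s s₂ t i
  have pg₁ : ∀ t i, SpacePeriodic (g₁ t i) := fun t i => flux_periodic (hA₁p t) (p₁ t) i
  have pg₂ : ∀ t i, SpacePeriodic (g₂ t i) := fun t i => flux_periodic (hA₂p t) (p₂ t) i
  have hne : ((⊤ : ℕ∞) : WithTop ℕ∞) ≠ 0 := by simp
  have spdW : ∀ t i x, spd i (W t) x = spd i (ϱ₁ t) x - spd i (ϱ₂ t) x := fun t i x =>
    spd_sub ((s₁.slice t).differentiable hne x) ((s₂.slice t).differentiable hne x) i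
  have eW : ∀ t ∈ Icc (0:ℝ) T, ∀ x, deriv (fun s => W s x) t + ∑ i, u t x i * spd i (W t) x
      = ∑ i, spd i (fun y => g₁ t i y - g₂ t i y) x := by
    intro t ht x
    have hd : deriv (fun s => W s x) t
        = deriv (fun s => ϱ₁ s x) t - deriv (fun s => ϱ₂ s x) t :=
      deriv_fun_sub (s₁.hasDerivAt_time t x).differentiableAt
        (s₂.hasDerivAt_time t x).differentiableAt
    have hg : ∀ i, spd i (fun y => g₁ t i y - g₂ t i y) x = spd i (g₁ t i) x - spd i (g₂ t i) x :=
      fun i => spd_sub ((cg₁ t i).differentiable hne x) ((cg₂ t i).differentiable hne x) i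
    have q₁ := e₁ t ht x
    have q₂ := e₂ t ht x
    simp only [hg, spdW, mul_sub, Finset.sum_sub_distrib, hd]
    linear_combination q₁ - q₂
  let D₁ : ℝ → E3 → ℝ := fun t x => ∑ i, g₁ t i x * spd i (ϱ₁ t) x
  let D₂ : ℝ → E3 → ℝ := fun t x => ∑ i, g₂ t i x * spd i (ϱ₂ t) x
  let DW : ℝ → E3 → ℝ := fun t x => ∑ i, (g₁ t i x - g₂ t i x) * spd i (W t) x
  have cD₁ : ∀ t, Continuous (D₁ t) := fun t => continuous_finsetSum _ fun i _ =>
    (cg₁ t i).continuous.mul (contDiff_spd (s₁.slice t) i).continuous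
  have cD₂ : ∀ t, Continuous (D₂ t) := fun t => continuous_finsetSum _ fun i _ =>
    (cg₂ t i).continuous.mul (contDiff_spd (s₂.slice t) i).continuous
  have cDW : ∀ t, Continuous (DW t) := fun t => continuous_finsetSum _ fun i _ =>
    ((cg₁ t i).continuous.sub (cg₂ t i).continuous).mul (contDiff_spd (sW.slice t) i).continuous
  have d₁ : ∀ t ∈ Icc (0:ℝ) T, HasDerivAt (fun s => L2sq (ϱ₁ s))
      (-2 * ∫ x in cube 3, D₁ t x) t := fun t ht =>
    hasDerivAt_L2sq_of_transport s₁ (p₁ t) (hu.slice t) (hup t) (hudiv t) (cg₁ t) (pg₁ t) (e₁ t ht)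
  have d₂ : ∀ t ∈ Icc (0:ℝ) T, HasDerivAt (fun s => L2sq (ϱ₂ s))
      (-2 * ∫ x in cube 3, D₂ t x) t := fun t ht =>
    hasDerivAt_L2sq_of_transport s₂ (p₂ t) (hu.slice t) (hup t) (hudiv t) (cg₂ t) (pg₂ t) (e₂ t ht)
  have dW : ∀ t ∈ Icc (0:ℝ) T, HasDerivAt (fun s => L2sq (W s))
      (-2 * ∫ x in cube 3, DW t x) t := fun t ht =>
    hasDerivAt_L2sq_of_transport sW (fun x m => by simp only [W, p₁ t x m, p₂ t x m])
      (hu.slice t) (hup t) (hudiv t) (fun i => (cg₁ t i).sub (cg₂ t i))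
      (fun i x m => by simp only [pg₁ t i x m, pg₂ t i x m]) (eW t ht)
  have decay : ∀ α β γ : ℝ,
      (∀ t ∈ Icc (0:ℝ) T, ∀ x, 0 ≤ α * D₂ t x + β * D₁ t x + γ * DW t x) →
      ∀ t ∈ Icc (0:ℝ) T, α * L2sq (ϱ₂ t) + β * L2sq (ϱ₁ t) + γ * L2sq (W t)
        ≤ (α + β) * L2sq ρin := by
    intro α β γ hnn t ht
    have hder : ∀ s ∈ Icc (0:ℝ) T, HasDerivAt
        (fun s => α * L2sq (ϱ₂ s) + β * L2sq (ϱ₁ s) + γ * L2sq (W s))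
        (-2 * ∫ x in cube 3, (α * D₂ s x + β * D₁ s x + γ * DW s x)) s := by
      intro s hs
      have I₁ := (integrableOn_cube (cD₁ s)).const_mul β
      have I₂ := (integrableOn_cube (cD₂ s)).const_mul α
      have IW := (integrableOn_cube (cDW s)).const_mul γ
      have h := (((d₂ s hs).const_mul α).add ((d₁ s hs).const_mul β)).add ((dW s hs).const_mul γ)
      refine h.congr_deriv ?_
      have I₂₁ : IntegrableOn (fun x => α * D₂ s x + β * D₁ s x) (cube 3) := I₂.add I₁
      rw [integral_add I₂₁ IW, integral_add I₂ I₁, integral_const_mul,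
        integral_const_mul, integral_const_mul]
      ring
    have hanti := antitoneOn_of_deriv_nonpos (convex_Icc (0:ℝ) T)
      (fun s hs => (hder s hs).continuousAt.continuousWithinAt)
      (fun s hs => (hder s (interior_subset hs)).differentiableAt.differentiableWithinAt)
      (fun s hs => by
        rw [(hder s (interior_subset hs)).deriv]
        have : 0 ≤ ∫ x in cube 3, (α * D₂ s x + β * D₁ s x + γ * DW s x) :=
          integral_nonneg fun x => hnn s (interior_subset hs) x
        linarith)
    have h := hanti (left_mem_Icc.2 hT.le) ht ht.1
    have z₁ : L2sq (ϱ₁ 0) = L2sq ρin := by rw [show ϱ₁ 0 = ρin from funext i₁]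
    have z₂ : L2sq (ϱ₂ 0) = L2sq ρin := by rw [show ϱ₂ 0 = ρin from funext i₂]
    have zW : L2sq (W 0) = 0 := by simp [L2sq, W, i₁, i₂]
    simp only [z₁, z₂, zW] at h
    linarith
  have pos₁ : ∀ t ∈ Icc (0:ℝ) T, ∀ x v, 0 ≤ qf (A₁ t x) v v := by
    obtain ⟨c, hc, h⟩ := hA₁ell
    exact fun t ht x v =>
      (mul_nonneg hc.le (Finset.sum_nonneg fun i _ => sq_nonneg (v i))).trans (h t ht x v)
  have D₂_eq : ∀ t x, D₂ t x
      = qf (A₂ t x) (fun i => spd i (ϱ₂ t) x) (fun i => spd i (ϱ₂ t) x) := by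
    intro t x
    simp only [D₂, g₂, qf, Fin.sum_univ_three]; ring
  have D₁_eq : ∀ t x, D₁ t x
      = qf (A₁ t x) (fun i => spd i (W t) x) (fun i => spd i (W t) x)
        + 2 * qf (A₁ t x) (fun i => spd i (W t) x) (fun i => spd i (ϱ₂ t) x)
        + qf (A₁ t x) (fun i => spd i (ϱ₂ t) x) (fun i => spd i (ϱ₂ t) x) := by
    intro t x
    have h := qf_add_smul (hA₁sym t x) (fun i => spd i (W t) x) (fun i => spd i (ϱ₂ t) x) 1
    simp only [mul_one, one_mul, one_pow] at h
    rw [← h]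
    simp only [D₁, g₁, qf, spdW, Fin.sum_univ_three, sub_add_cancel]; ring
  have DW_eq : ∀ t x, DW t x
      = qf (A₁ t x) (fun i => spd i (W t) x) (fun i => spd i (W t) x)
        + (qf (A₁ t x) (fun i => spd i (W t) x) (fun i => spd i (ϱ₂ t) x)
          - qf (A₂ t x) (fun i => spd i (W t) x) (fun i => spd i (ϱ₂ t) x)) := by
    intro t x
    simp only [DW, g₁, g₂, qf, spdW, Fin.sum_univ_three]; ring
  intro t ht
  have nonneg_W := L2sq_nonneg (W t)
  have abs_ge := le_abs_self (L2sq ρin - L2sq (ϱ₂ t))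
  constructor
  · have h := decay (2 * ε ^ 2) 0 1 (fun s hs x => by
      rw [D₂_eq, DW_eq, zero_mul, one_mul, add_zero]
      exact dissipation_combination_nonneg (pos₁ s hs x) hε (hclose s hs x) _ _) t ht
    have h' := mul_le_mul_of_nonneg_left abs_ge (by positivity : 0 ≤ 2 * ε ^ 2)
    change L2sq (W t) ≤ _
    linarith
  · have signed : ∀ σ : ℝ, |σ| = 1 → σ * (L2sq (ϱ₁ t) - L2sq (ϱ₂ t))
        ≤ 10 * ε * |L2sq ρin - L2sq (ϱ₂ t)| := by
      intro σ hσ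
      have h := decay (10 * ε - σ) σ (2 + 2 / ε) (fun s hs x => by
        rw [D₂_eq, D₁_eq, DW_eq]
        exact signed_dissipation_combination_nonneg (hA₁sym s x) (pos₁ s hs x) hε0 hε
          (hclose s hs x) _ _ hσ) t ht
      have h' := mul_le_mul_of_nonneg_left abs_ge (by positivity : 0 ≤ 10 * ε)
      have h'' : 0 ≤ (2 + 2 / ε) * L2sq (W t) := mul_nonneg (by positivity) nonneg_W
      linarith
    have hplus := signed 1 (by simp)
    have hminus := signed (-1) (by simp)
    exact abs_le.2 ⟨by linarith, by linarith⟩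

end
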